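/- (Theorem 3.2) Let T be an invertible block TBT-matrix and μ = (μ₁,μ₂) with μ₁,μ₂ ∉ {i/2, −i/2}. Then u(μ)E(μ) = ϑ(μ)[ℒ₂^* 0 ℒ₁^* 0], where u(μ) = [u₁(μ) u₂(μ)] and ϑ(μ) = −i(I_{m₃} + ℒ^*(A₁^*−μ₁I)^{−1}(A₂^*−μ₂I)^{−1}RN), with N = col[(1/2)M₁₂^{(0)}, (1/2)M₁₂^{(0)}+M₁₂^{(1)}, …, (1/2)M₁₂^{(0)}+Σ_{j=1}^{m₁−1}M₁₂^{(j)}]. In particular, if E(μ) is invertible then u(μ) = ϑ(μ)[ℒ₂^* 0 ℒ₁^* 0]E(μ)^{−1}. -/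

import Mathlib

open Matrix Kronecker BigOperators

noncomputable section

namespace TBT

/-- The entries `a_r` of the matrices `𝒜_p`. -/
def aEnt (r : ℤ) : ℂ := if r < 0 then 0 else if r = 0 then Complex.I / 2 else Complex.I

/-- The `n × n` matrix `𝒜 = {a_{j-ℓ}}`. -/
def calA (n : ℕ) : Matrix (Fin n) (Fin n) ℂ :=
  Matrix.of fun j ℓ => aEnt (((j : ℕ) : ℤ) - ((ℓ : ℕ) : ℤ))

/-- The index type of the `m × m` matrices, `m = m₁ m₂ m₃`. -/
abbrev Idx (m₁ m₂ m₃ : ℕ) := (Fin m₁ × Fin m₂) × Fin m₃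

/-- `A₁ = 𝒜₁ ⊗ I_{m₂} ⊗ I_{m₃}`. -/
def A1 (m₁ m₂ m₃ : ℕ) : Matrix (Idx m₁ m₂ m₃) (Idx m₁ m₂ m₃) ℂ :=
  (calA m₁ ⊗ₖ (1 : Matrix (Fin m₂) (Fin m₂) ℂ)) ⊗ₖ (1 : Matrix (Fin m₃) (Fin m₃) ℂ)

/-- `A₂ = I_{m₁} ⊗ 𝒜₂ ⊗ I_{m₃}`. -/
def A2 (m₁ m₂ m₃ : ℕ) : Matrix (Idx m₁ m₂ m₃) (Idx m₁ m₂ m₃) ℂ :=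
  ((1 : Matrix (Fin m₁) (Fin m₁) ℂ) ⊗ₖ calA m₂) ⊗ₖ (1 : Matrix (Fin m₃) (Fin m₃) ℂ)

/-- `A₃ = I_{m₁} ⊗ I_{m₂} ⊗ 𝒜₃`. -/
def A3 (m₁ m₂ m₃ : ℕ) : Matrix (Idx m₁ m₂ m₃) (Idx m₁ m₂ m₃) ℂ :=
  ((1 : Matrix (Fin m₁) (Fin m₁) ℂ) ⊗ₖ (1 : Matrix (Fin m₂) (Fin m₂) ℂ)) ⊗ₖ calA m₃

/-- The block TBT-matrix `T = {𝒯_{i-k}}`, `𝒯_r = {t^{(r)}_{i-k}}`, built from the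
data `t : ℤ → ℤ → Matrix (Fin m₃) (Fin m₃) ℂ` of its `m₃ × m₃` blocks. -/
def Tmat (m₁ m₂ m₃ : ℕ) (t : ℤ → ℤ → Matrix (Fin m₃) (Fin m₃) ℂ) :
    Matrix (Idx m₁ m₂ m₃) (Idx m₁ m₂ m₃) ℂ :=
  Matrix.of fun x y =>
    t (((x.1.1 : ℕ) : ℤ) - ((y.1.1 : ℕ) : ℤ)) (((x.1.2 : ℕ) : ℤ) - ((y.1.2 : ℕ) : ℤ)) x.2 y.2

/-- The Toeplitz blocks `𝒯_r = {t^{(r)}_{i-k}}` of a block TBT-matrix. -/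
def calT (m₂ m₃ : ℕ) (t : ℤ → ℤ → Matrix (Fin m₃) (Fin m₃) ℂ) (r : ℤ) :
    Matrix (Fin m₂ × Fin m₃) (Fin m₂ × Fin m₃) ℂ :=
  Matrix.of fun x y => t r (((x.1 : ℕ) : ℤ) - ((y.1 : ℕ) : ℤ)) x.2 y.2

/-- `M₁₁ = col [M₁₁⁽¹⁾ … M₁₁⁽ᵐ¹⁾]`, `M₁₁⁽ⁱ⁾ = (1/2)𝒯₀ + Σ_{s=1}^{i-1} 𝒯_s`. -/
def M11 (m₁ m₂ m₃ : ℕ) (t : ℤ → ℤ → Matrix (Fin m₃) (Fin m₃) ℂ) :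
    Matrix (Idx m₁ m₂ m₃) (Fin m₂ × Fin m₃) ℂ :=
  Matrix.of fun x y =>
    ((2 : ℂ)⁻¹ • calT m₂ m₃ t 0 +
      ∑ s ∈ Finset.range (x.1.1 : ℕ), calT m₂ m₃ t ((s : ℤ) + 1)) (x.1.2, x.2) y

/-- `M₂₁ = 1_{m₁}^* ⊗ I_{m₂ m₃}`. -/
def M21 (m₁ m₂ m₃ : ℕ) : Matrix (Fin m₂ × Fin m₃) (Idx m₁ m₂ m₃) ℂ :=
  Matrix.of fun y x => if y.1 = x.1.2 ∧ y.2 = x.2 then 1 else 0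

/-- `M₃₁ = M₂₁^*`. -/
def M31 (m₁ m₂ m₃ : ℕ) : Matrix (Idx m₁ m₂ m₃) (Fin m₂ × Fin m₃) ℂ := (M21 m₁ m₂ m₃)ᴴ

/-- `M₄₁ = [M₄₁⁽¹⁾ … M₄₁⁽ᵐ¹⁾]`, `M₄₁⁽ᵏ⁾ = (1/2)𝒯₀ + Σ_{s=1}^{k-1} 𝒯_{-s}`. -/
def M41 (m₁ m₂ m₃ : ℕ) (t : ℤ → ℤ → Matrix (Fin m₃) (Fin m₃) ℂ) :
    Matrix (Fin m₂ × Fin m₃) (Idx m₁ m₂ m₃) ℂ :=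
  Matrix.of fun y x =>
    ((2 : ℂ)⁻¹ • calT m₂ m₃ t 0 +
      ∑ s ∈ Finset.range (x.1.1 : ℕ), calT m₂ m₃ t (-((s : ℤ) + 1))) y (x.1.2, x.2)

/-- The blocks `M₁₂⁽ʳ⁾ = col [(1/2)t₀⁽ʳ⁾, (1/2)t₀⁽ʳ⁾ + t₁⁽ʳ⁾, …]`. -/
def M12blk (m₂ m₃ : ℕ) (t : ℤ → ℤ → Matrix (Fin m₃) (Fin m₃) ℂ) (r : ℤ) :
    Matrix (Fin m₂ × Fin m₃) (Fin m₃) ℂ :=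
  Matrix.of fun x l =>
    ((2 : ℂ)⁻¹ • t r 0 + ∑ j ∈ Finset.range (x.1 : ℕ), t r ((j : ℤ) + 1)) x.2 l

/-- `M₁₂ = {M₁₂^{(i-k)}}_{i,k=1}^{m₁}`. -/
def M12 (m₁ m₂ m₃ : ℕ) (t : ℤ → ℤ → Matrix (Fin m₃) (Fin m₃) ℂ) :
    Matrix (Idx m₁ m₂ m₃) (Fin m₁ × Fin m₃) ℂ :=
  Matrix.of fun x y => M12blk m₂ m₃ t (((x.1.1 : ℕ) : ℤ) - ((y.1 : ℕ) : ℤ)) (x.1.2, x.2) y.2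

/-- `M₂₂ = I_{m₁} ⊗ 1_{m₂}^* ⊗ I_{m₃}`. -/
def M22 (m₁ m₂ m₃ : ℕ) : Matrix (Fin m₁ × Fin m₃) (Idx m₁ m₂ m₃) ℂ :=
  Matrix.of fun y x => if y.1 = x.1.1 ∧ y.2 = x.2 then 1 else 0

/-- `M₃₂ = M₂₂^*`. -/
def M32 (m₁ m₂ m₃ : ℕ) : Matrix (Idx m₁ m₂ m₃) (Fin m₁ × Fin m₃) ℂ := (M22 m₁ m₂ m₃)ᴴ

/-- The blocks `M₄₂⁽ʳ⁾ = [(1/2)t₀⁽ʳ⁾, (1/2)t₀⁽ʳ⁾ + t₋₁⁽ʳ⁾, …]`. -/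
def M42blk (m₂ m₃ : ℕ) (t : ℤ → ℤ → Matrix (Fin m₃) (Fin m₃) ℂ) (r : ℤ) :
    Matrix (Fin m₃) (Fin m₂ × Fin m₃) ℂ :=
  Matrix.of fun l x =>
    ((2 : ℂ)⁻¹ • t r 0 + ∑ j ∈ Finset.range (x.1 : ℕ), t r (-((j : ℤ) + 1))) l x.2

/-- `M₄₂ = {M₄₂^{(i-k)}}_{i,k=1}^{m₁}`. -/
def M42 (m₁ m₂ m₃ : ℕ) (t : ℤ → ℤ → Matrix (Fin m₃) (Fin m₃) ℂ) :
    Matrix (Fin m₁ × Fin m₃) (Idx m₁ m₂ m₃) ℂ :=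
  Matrix.of fun y x => M42blk m₂ m₃ t (((y.1 : ℕ) : ℤ) - ((x.1.1 : ℕ) : ℤ)) y.2 (x.1.2, x.2)

/-- `Π₁ = [M₁₁ M₃₁]`. -/
def Pi1 (m₁ m₂ m₃ : ℕ) (t : ℤ → ℤ → Matrix (Fin m₃) (Fin m₃) ℂ) :
    Matrix (Idx m₁ m₂ m₃) ((Fin m₂ × Fin m₃) ⊕ (Fin m₂ × Fin m₃)) ℂ :=
  Matrix.fromCols (M11 m₁ m₂ m₃ t) (M31 m₁ m₂ m₃)

/-- `Π₂ = [M₁₂ M₃₂]`. -/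
def Pi2 (m₁ m₂ m₃ : ℕ) (t : ℤ → ℤ → Matrix (Fin m₃) (Fin m₃) ℂ) :
    Matrix (Idx m₁ m₂ m₃) ((Fin m₁ × Fin m₃) ⊕ (Fin m₁ × Fin m₃)) ℂ :=
  Matrix.fromCols (M12 m₁ m₂ m₃ t) (M32 m₁ m₂ m₃)

/-- `Π̂₁ = col [M₂₁; M₄₁]`. -/
def Pihat1 (m₁ m₂ m₃ : ℕ) (t : ℤ → ℤ → Matrix (Fin m₃) (Fin m₃) ℂ) :
    Matrix ((Fin m₂ × Fin m₃) ⊕ (Fin m₂ × Fin m₃)) (Idx m₁ m₂ m₃) ℂ :=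
  Matrix.fromRows (M21 m₁ m₂ m₃) (M41 m₁ m₂ m₃ t)

/-- `Π̂₂ = col [M₂₂; M₄₂]`. -/
def Pihat2 (m₁ m₂ m₃ : ℕ) (t : ℤ → ℤ → Matrix (Fin m₃) (Fin m₃) ℂ) :
    Matrix ((Fin m₁ × Fin m₃) ⊕ (Fin m₁ × Fin m₃)) (Idx m₁ m₂ m₃) ℂ :=
  Matrix.fromRows (M22 m₁ m₂ m₃) (M42 m₁ m₂ m₃ t)

/-- `Γ₁ = T⁻¹ Π₁`. -/
def Gamma1 (m₁ m₂ m₃ : ℕ) (t : ℤ → ℤ → Matrix (Fin m₃) (Fin m₃) ℂ) :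
    Matrix (Idx m₁ m₂ m₃) ((Fin m₂ × Fin m₃) ⊕ (Fin m₂ × Fin m₃)) ℂ :=
  (Tmat m₁ m₂ m₃ t)⁻¹ * Pi1 m₁ m₂ m₃ t

/-- `Γ₂ = T⁻¹ Π₂`. -/
def Gamma2 (m₁ m₂ m₃ : ℕ) (t : ℤ → ℤ → Matrix (Fin m₃) (Fin m₃) ℂ) :
    Matrix (Idx m₁ m₂ m₃) ((Fin m₁ × Fin m₃) ⊕ (Fin m₁ × Fin m₃)) ℂ :=
  (Tmat m₁ m₂ m₃ t)⁻¹ * Pi2 m₁ m₂ m₃ t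

/-- `Γ̂₁ = Π̂₁ T⁻¹`. -/
def Gammahat1 (m₁ m₂ m₃ : ℕ) (t : ℤ → ℤ → Matrix (Fin m₃) (Fin m₃) ℂ) :
    Matrix ((Fin m₂ × Fin m₃) ⊕ (Fin m₂ × Fin m₃)) (Idx m₁ m₂ m₃) ℂ :=
  Pihat1 m₁ m₂ m₃ t * (Tmat m₁ m₂ m₃ t)⁻¹

/-- `Γ̂₂ = Π̂₂ T⁻¹`. -/
def Gammahat2 (m₁ m₂ m₃ : ℕ) (t : ℤ → ℤ → Matrix (Fin m₃) (Fin m₃) ℂ) :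
    Matrix ((Fin m₁ × Fin m₃) ⊕ (Fin m₁ × Fin m₃)) (Idx m₁ m₂ m₃) ℂ :=
  Pihat2 m₁ m₂ m₃ t * (Tmat m₁ m₂ m₃ t)⁻¹

/-- `ℒ = 1_{m₁m₂} ⊗ I_{m₃}`. -/
def Lmat (m₁ m₂ m₃ : ℕ) : Matrix (Idx m₁ m₂ m₃) (Fin m₃) ℂ :=
  Matrix.of fun x l => if x.2 = l then 1 else 0

/-- `ℒ_p = 1_{m_p} ⊗ I_{m₃}`. -/
def Lp (n m₃ : ℕ) : Matrix (Fin n × Fin m₃) (Fin m₃) ℂ :=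
  Matrix.of fun x l => if x.2 = l then 1 else 0

/-- A row vector `v` Kronecker the identity `I_{m₃}`. -/
def rowKronId {n : Type*} (m₃ : ℕ) (v : n → ℂ) : Matrix (Fin m₃) (n × Fin m₃) ℂ :=
  Matrix.of fun l x => v x.1 * (if l = x.2 then 1 else 0)

/-- A column vector `v` Kronecker the identity `I_{m₃}`. -/
def colKronId {n : Type*} (m₃ : ℕ) (v : n → ℂ) : Matrix (n × Fin m₃) (Fin m₃) ℂ :=
  Matrix.of fun x l => v x.1 * (if x.2 = l then 1 else 0)

/-- `ω(λ,μ) = ℒ^* (A₁^*-μ₁I)⁻¹ (A₂^*-μ₂I)⁻¹ T⁻¹ (A₁-λ₁I)⁻¹ (A₂-λ₂I)⁻¹ ℒ`. -/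
def omegaF (m₁ m₂ m₃ : ℕ) (t : ℤ → ℤ → Matrix (Fin m₃) (Fin m₃) ℂ) (l₁ l₂ mu₁ mu₂ : ℂ) :
    Matrix (Fin m₃) (Fin m₃) ℂ :=
  (Lmat m₁ m₂ m₃)ᴴ * ((A1 m₁ m₂ m₃)ᴴ - mu₁ • 1)⁻¹ * ((A2 m₁ m₂ m₃)ᴴ - mu₂ • 1)⁻¹ *
    (Tmat m₁ m₂ m₃ t)⁻¹ * (A1 m₁ m₂ m₃ - l₁ • 1)⁻¹ * (A2 m₁ m₂ m₃ - l₂ • 1)⁻¹ *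
    Lmat m₁ m₂ m₃

/-- `v₁(μ) = ℒ^* (A₁^*-μ₁I)⁻¹ (A₂^*-μ₂I)⁻¹ Γ₁`. -/
def v1 (m₁ m₂ m₃ : ℕ) (t : ℤ → ℤ → Matrix (Fin m₃) (Fin m₃) ℂ) (mu₁ mu₂ : ℂ) :
    Matrix (Fin m₃) ((Fin m₂ × Fin m₃) ⊕ (Fin m₂ × Fin m₃)) ℂ :=
  (Lmat m₁ m₂ m₃)ᴴ * ((A1 m₁ m₂ m₃)ᴴ - mu₁ • 1)⁻¹ * ((A2 m₁ m₂ m₃)ᴴ - mu₂ • 1)⁻¹ *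
    Gamma1 m₁ m₂ m₃ t

/-- `v₂(μ) = ℒ^* (A₁^*-μ₁I)⁻¹ (A₂^*-μ₂I)⁻¹ Γ₂`. -/
def v2 (m₁ m₂ m₃ : ℕ) (t : ℤ → ℤ → Matrix (Fin m₃) (Fin m₃) ℂ) (mu₁ mu₂ : ℂ) :
    Matrix (Fin m₃) ((Fin m₁ × Fin m₃) ⊕ (Fin m₁ × Fin m₃)) ℂ :=
  (Lmat m₁ m₂ m₃)ᴴ * ((A1 m₁ m₂ m₃)ᴴ - mu₁ • 1)⁻¹ * ((A2 m₁ m₂ m₃)ᴴ - mu₂ • 1)⁻¹ *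
    Gamma2 m₁ m₂ m₃ t

/-- `v̂₁(λ) = Γ̂₁ (A₁-λ₁I)⁻¹ (A₂-λ₂I)⁻¹ ℒ`. -/
def vhat1 (m₁ m₂ m₃ : ℕ) (t : ℤ → ℤ → Matrix (Fin m₃) (Fin m₃) ℂ) (l₁ l₂ : ℂ) :
    Matrix ((Fin m₂ × Fin m₃) ⊕ (Fin m₂ × Fin m₃)) (Fin m₃) ℂ :=
  Gammahat1 m₁ m₂ m₃ t * (A1 m₁ m₂ m₃ - l₁ • 1)⁻¹ * (A2 m₁ m₂ m₃ - l₂ • 1)⁻¹ * Lmat m₁ m₂ m₃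

/-- `v̂₂(λ) = Γ̂₂ (A₁-λ₁I)⁻¹ (A₂-λ₂I)⁻¹ ℒ`. -/
def vhat2 (m₁ m₂ m₃ : ℕ) (t : ℤ → ℤ → Matrix (Fin m₃) (Fin m₃) ℂ) (l₁ l₂ : ℂ) :
    Matrix ((Fin m₁ × Fin m₃) ⊕ (Fin m₁ × Fin m₃)) (Fin m₃) ℂ :=
  Gammahat2 m₁ m₂ m₃ t * (A1 m₁ m₂ m₃ - l₁ • 1)⁻¹ * (A2 m₁ m₂ m₃ - l₂ • 1)⁻¹ * Lmat m₁ m₂ m₃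

/-- `u₁(μ) = v₁(μ) - i (1_{m₂}^* (𝒜₂^*-μ₂I)⁻¹ ⊗ I_{m₃}) [I_{m₂m₃} 0]`. -/
def u1 (m₁ m₂ m₃ : ℕ) (t : ℤ → ℤ → Matrix (Fin m₃) (Fin m₃) ℂ) (mu₁ mu₂ : ℂ) :
    Matrix (Fin m₃) ((Fin m₂ × Fin m₃) ⊕ (Fin m₂ × Fin m₃)) ℂ :=
  v1 m₁ m₂ m₃ t mu₁ mu₂ -
    Complex.I • Matrix.fromCols
      (rowKronId m₃ (Matrix.vecMul (fun _ : Fin m₂ => (1 : ℂ)) (((calA m₂)ᴴ - mu₂ • 1)⁻¹))) 0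

/-- `u₂(μ) = v₂(μ) - i (1_{m₁}^* (𝒜₁^*-μ₁I)⁻¹ ⊗ I_{m₃}) [I_{m₁m₃} 0]`. -/
def u2 (m₁ m₂ m₃ : ℕ) (t : ℤ → ℤ → Matrix (Fin m₃) (Fin m₃) ℂ) (mu₁ mu₂ : ℂ) :
    Matrix (Fin m₃) ((Fin m₁ × Fin m₃) ⊕ (Fin m₁ × Fin m₃)) ℂ :=
  v2 m₁ m₂ m₃ t mu₁ mu₂ -
    Complex.I • Matrix.fromCols
      (rowKronId m₃ (Matrix.vecMul (fun _ : Fin m₁ => (1 : ℂ)) (((calA m₁)ᴴ - mu₁ • 1)⁻¹))) 0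

/-- `û₁(λ) = v̂₁(λ) + i col[0; I_{m₂m₃}] ((𝒜₂-λ₂I)⁻¹ 1_{m₂} ⊗ I_{m₃})`. -/
def uhat1 (m₁ m₂ m₃ : ℕ) (t : ℤ → ℤ → Matrix (Fin m₃) (Fin m₃) ℂ) (l₁ l₂ : ℂ) :
    Matrix ((Fin m₂ × Fin m₃) ⊕ (Fin m₂ × Fin m₃)) (Fin m₃) ℂ :=
  vhat1 m₁ m₂ m₃ t l₁ l₂ +
    Complex.I • Matrix.fromRows 0
      (colKronId m₃ (Matrix.mulVec ((calA m₂ - l₂ • 1)⁻¹) (fun _ : Fin m₂ => (1 : ℂ))))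

/-- `û₂(λ) = v̂₂(λ) + i col[0; I_{m₁m₃}] ((𝒜₁-λ₁I)⁻¹ 1_{m₁} ⊗ I_{m₃})`. -/
def uhat2 (m₁ m₂ m₃ : ℕ) (t : ℤ → ℤ → Matrix (Fin m₃) (Fin m₃) ℂ) (l₁ l₂ : ℂ) :
    Matrix ((Fin m₁ × Fin m₃) ⊕ (Fin m₁ × Fin m₃)) (Fin m₃) ℂ :=
  vhat2 m₁ m₂ m₃ t l₁ l₂ +
    Complex.I • Matrix.fromRows 0
      (colKronId m₃ (Matrix.mulVec ((calA m₁ - l₁ • 1)⁻¹) (fun _ : Fin m₁ => (1 : ℂ))))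

/-- `K₁₁ = col [(1/2)M₄₂⁽⁰⁾, (1/2)M₄₂⁽⁰⁾+M₄₂⁽¹⁾, …]`. -/
def K11 (m₁ m₂ m₃ : ℕ) (t : ℤ → ℤ → Matrix (Fin m₃) (Fin m₃) ℂ) :
    Matrix (Fin m₁ × Fin m₃) (Fin m₂ × Fin m₃) ℂ :=
  Matrix.of fun y x =>
    ((2 : ℂ)⁻¹ • M42blk m₂ m₃ t 0 +
      ∑ j ∈ Finset.range (y.1 : ℕ), M42blk m₂ m₃ t ((j : ℤ) + 1)) y.2 x

/-- `K₁₂ = [(1/2)M₁₂⁽⁰⁾, (1/2)M₁₂⁽⁰⁾+M₁₂⁽⁻¹⁾, …]`. -/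
def K12 (m₁ m₂ m₃ : ℕ) (t : ℤ → ℤ → Matrix (Fin m₃) (Fin m₃) ℂ) :
    Matrix (Fin m₂ × Fin m₃) (Fin m₁ × Fin m₃) ℂ :=
  Matrix.of fun y x =>
    ((2 : ℂ)⁻¹ • M12blk m₂ m₃ t 0 +
      ∑ j ∈ Finset.range (x.1 : ℕ), M12blk m₂ m₃ t (-((j : ℤ) + 1))) y x.2

/-- `K = [(1/2)M₄₂⁽⁰⁾, (1/2)M₄₂⁽⁰⁾+M₄₂⁽⁻¹⁾, …]`. -/
def Kmat (m₁ m₂ m₃ : ℕ) (t : ℤ → ℤ → Matrix (Fin m₃) (Fin m₃) ℂ) :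
    Matrix (Fin m₃) (Idx m₁ m₂ m₃) ℂ :=
  Matrix.of fun l x =>
    ((2 : ℂ)⁻¹ • M42blk m₂ m₃ t 0 +
      ∑ j ∈ Finset.range (x.1.1 : ℕ), M42blk m₂ m₃ t (-((j : ℤ) + 1))) l (x.1.2, x.2)

/-- `N = col [(1/2)M₁₂⁽⁰⁾, (1/2)M₁₂⁽⁰⁾+M₁₂⁽¹⁾, …]`. -/
def Nmat (m₁ m₂ m₃ : ℕ) (t : ℤ → ℤ → Matrix (Fin m₃) (Fin m₃) ℂ) :
    Matrix (Idx m₁ m₂ m₃) (Fin m₃) ℂ :=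
  Matrix.of fun x l =>
    ((2 : ℂ)⁻¹ • M12blk m₂ m₃ t 0 +
      ∑ j ∈ Finset.range (x.1.1 : ℕ), M12blk m₂ m₃ t ((j : ℤ) + 1)) (x.1.2, x.2) l

/-- `diag {(𝒜-zI) ⊗ I_{m₃}, (𝒜-zI) ⊗ I_{m₃}}` (the diagonal blocks `G₁₁`, `G₂₂`). -/
def diagKron (n m₃ : ℕ) (z : ℂ) :
    Matrix ((Fin n × Fin m₃) ⊕ (Fin n × Fin m₃)) ((Fin n × Fin m₃) ⊕ (Fin n × Fin m₃)) ℂ :=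
  Matrix.fromBlocks ((calA n - z • 1) ⊗ₖ (1 : Matrix (Fin m₃) (Fin m₃) ℂ)) 0 0
    ((calA n - z • 1) ⊗ₖ (1 : Matrix (Fin m₃) (Fin m₃) ℂ))

/-- `diag {(𝒜^*-zI) ⊗ I_{m₃}, (𝒜^*-zI) ⊗ I_{m₃}}` (the diagonal blocks `E₁₁`, `E₂₂`). -/
def diagKronH (n m₃ : ℕ) (z : ℂ) :
    Matrix ((Fin n × Fin m₃) ⊕ (Fin n × Fin m₃)) ((Fin n × Fin m₃) ⊕ (Fin n × Fin m₃)) ℂ :=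
  Matrix.fromBlocks (((calA n)ᴴ - z • 1) ⊗ₖ (1 : Matrix (Fin m₃) (Fin m₃) ℂ)) 0 0
    (((calA n)ᴴ - z • 1) ⊗ₖ (1 : Matrix (Fin m₃) (Fin m₃) ℂ))

/-- `𝔄(z) = diag {(𝒜^*-zI) ⊗ I_{m₃}, (𝒜-zI) ⊗ I_{m₃}}`. -/
def frakA (n m₃ : ℕ) (z : ℂ) :
    Matrix ((Fin n × Fin m₃) ⊕ (Fin n × Fin m₃)) ((Fin n × Fin m₃) ⊕ (Fin n × Fin m₃)) ℂ :=
  Matrix.fromBlocks (((calA n)ᴴ - z • 1) ⊗ₖ (1 : Matrix (Fin m₃) (Fin m₃) ℂ)) 0 0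
    ((calA n - z • 1) ⊗ₖ (1 : Matrix (Fin m₃) (Fin m₃) ℂ))

/-- `G₁₂ = i (Π̂₁ Γ₂ - [[ℒ₂ℒ₁^*, 0], [K₁₂, 0]])`. -/
def G12 (m₁ m₂ m₃ : ℕ) (t : ℤ → ℤ → Matrix (Fin m₃) (Fin m₃) ℂ) :
    Matrix ((Fin m₂ × Fin m₃) ⊕ (Fin m₂ × Fin m₃)) ((Fin m₁ × Fin m₃) ⊕ (Fin m₁ × Fin m₃)) ℂ :=
  Complex.I • (Pihat1 m₁ m₂ m₃ t * Gamma2 m₁ m₂ m₃ t -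
    Matrix.fromBlocks (Lp m₂ m₃ * (Lp m₁ m₃)ᴴ) 0 (K12 m₁ m₂ m₃ t) 0)

/-- `G₂₁ = i (Π̂₂ Γ₁ - [[ℒ₁ℒ₂^*, 0], [K₁₁, 0]])`. -/
def G21 (m₁ m₂ m₃ : ℕ) (t : ℤ → ℤ → Matrix (Fin m₃) (Fin m₃) ℂ) :
    Matrix ((Fin m₁ × Fin m₃) ⊕ (Fin m₁ × Fin m₃)) ((Fin m₂ × Fin m₃) ⊕ (Fin m₂ × Fin m₃)) ℂ :=
  Complex.I • (Pihat2 m₁ m₂ m₃ t * Gamma1 m₁ m₂ m₃ t -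
    Matrix.fromBlocks (Lp m₁ m₃ * (Lp m₂ m₃)ᴴ) 0 (K11 m₁ m₂ m₃ t) 0)

/-- `G(λ) = [[G₁₁(λ₂), G₁₂], [G₂₁, G₂₂(λ₁)]]`. -/
def Gmat (m₁ m₂ m₃ : ℕ) (t : ℤ → ℤ → Matrix (Fin m₃) (Fin m₃) ℂ) (l₁ l₂ : ℂ) :
    Matrix ((((Fin m₂ × Fin m₃) ⊕ (Fin m₂ × Fin m₃))) ⊕ (((Fin m₁ × Fin m₃) ⊕ (Fin m₁ × Fin m₃))))
      ((((Fin m₂ × Fin m₃) ⊕ (Fin m₂ × Fin m₃))) ⊕ (((Fin m₁ × Fin m₃) ⊕ (Fin m₁ × Fin m₃)))) ℂ :=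
  Matrix.fromBlocks (diagKron m₂ m₃ l₂) (G12 m₁ m₂ m₃ t) (G21 m₁ m₂ m₃ t) (diagKron m₁ m₃ l₁)

/-- `E₁₂ = -i (Π̂₁ Γ₂ - [[0, 0], [K₁₂, ℒ₂ℒ₁^*]])`. -/
def E12m (m₁ m₂ m₃ : ℕ) (t : ℤ → ℤ → Matrix (Fin m₃) (Fin m₃) ℂ) :
    Matrix ((Fin m₂ × Fin m₃) ⊕ (Fin m₂ × Fin m₃)) ((Fin m₁ × Fin m₃) ⊕ (Fin m₁ × Fin m₃)) ℂ :=
  (-Complex.I) • (Pihat1 m₁ m₂ m₃ t * Gamma2 m₁ m₂ m₃ t -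
    Matrix.fromBlocks 0 0 (K12 m₁ m₂ m₃ t) (Lp m₂ m₃ * (Lp m₁ m₃)ᴴ))

/-- `E₂₁ = -i (Π̂₂ Γ₁ - [[0, 0], [K₁₁, ℒ₁ℒ₂^*]])`. -/
def E21m (m₁ m₂ m₃ : ℕ) (t : ℤ → ℤ → Matrix (Fin m₃) (Fin m₃) ℂ) :
    Matrix ((Fin m₁ × Fin m₃) ⊕ (Fin m₁ × Fin m₃)) ((Fin m₂ × Fin m₃) ⊕ (Fin m₂ × Fin m₃)) ℂ :=
  (-Complex.I) • (Pihat2 m₁ m₂ m₃ t * Gamma1 m₁ m₂ m₃ t -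
    Matrix.fromBlocks 0 0 (K11 m₁ m₂ m₃ t) (Lp m₁ m₃ * (Lp m₂ m₃)ᴴ))

/-- `E(μ) = [[E₁₁(μ₂), E₁₂], [E₂₁, E₂₂(μ₁)]]`. -/
def Emat (m₁ m₂ m₃ : ℕ) (t : ℤ → ℤ → Matrix (Fin m₃) (Fin m₃) ℂ) (mu₁ mu₂ : ℂ) :
    Matrix ((((Fin m₂ × Fin m₃) ⊕ (Fin m₂ × Fin m₃))) ⊕ (((Fin m₁ × Fin m₃) ⊕ (Fin m₁ × Fin m₃))))
      ((((Fin m₂ × Fin m₃) ⊕ (Fin m₂ × Fin m₃))) ⊕ (((Fin m₁ × Fin m₃) ⊕ (Fin m₁ × Fin m₃)))) ℂ :=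
  Matrix.fromBlocks (diagKronH m₂ m₃ mu₂) (E12m m₁ m₂ m₃ t) (E21m m₁ m₂ m₃ t) (diagKronH m₁ m₃ mu₁)

/-- `θ(λ) = i (I_{m₃} + K R (A₁-λ₁I)⁻¹ (A₂-λ₂I)⁻¹ ℒ)`. -/
def theta (m₁ m₂ m₃ : ℕ) (t : ℤ → ℤ → Matrix (Fin m₃) (Fin m₃) ℂ) (l₁ l₂ : ℂ) :
    Matrix (Fin m₃) (Fin m₃) ℂ :=
  Complex.I • (1 + Kmat m₁ m₂ m₃ t * (Tmat m₁ m₂ m₃ t)⁻¹ *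
    (A1 m₁ m₂ m₃ - l₁ • 1)⁻¹ * (A2 m₁ m₂ m₃ - l₂ • 1)⁻¹ * Lmat m₁ m₂ m₃)

/-- `ϑ(μ) = -i (I_{m₃} + ℒ^* (A₁^*-μ₁I)⁻¹ (A₂^*-μ₂I)⁻¹ R N)`. -/
def vartheta (m₁ m₂ m₃ : ℕ) (t : ℤ → ℤ → Matrix (Fin m₃) (Fin m₃) ℂ) (mu₁ mu₂ : ℂ) :
    Matrix (Fin m₃) (Fin m₃) ℂ :=
  (-Complex.I) • (1 + (Lmat m₁ m₂ m₃)ᴴ * ((A1 m₁ m₂ m₃)ᴴ - mu₁ • 1)⁻¹ *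
    ((A2 m₁ m₂ m₃)ᴴ - mu₂ • 1)⁻¹ * (Tmat m₁ m₂ m₃ t)⁻¹ * Nmat m₁ m₂ m₃ t)

/-- The exchange (anti-diagonal) matrix `U_n = {δ_{n-i-k+1}}`. -/
def Up (n : ℕ) : Matrix (Fin n) (Fin n) ℂ :=
  Matrix.of fun i k => if (i : ℕ) + (k : ℕ) + 1 = n then 1 else 0

/-- `U = U₁ ⊗ U₂ ⊗ U₃`. -/
def Umat (m₁ m₂ m₃ : ℕ) : Matrix (Idx m₁ m₂ m₃) (Idx m₁ m₂ m₃) ℂ :=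
  (Up m₁ ⊗ₖ Up m₂) ⊗ₖ Up m₃

/-- `Ũ_k = [[0, -(U_k ⊗ U₃)], [U_k ⊗ U₃, 0]]`. -/
def Utilde (n m₃ : ℕ) :
    Matrix ((Fin n × Fin m₃) ⊕ (Fin n × Fin m₃)) ((Fin n × Fin m₃) ⊕ (Fin n × Fin m₃)) ℂ :=
  Matrix.fromBlocks 0 (-(Up n ⊗ₖ Up m₃)) (Up n ⊗ₖ Up m₃) 0

/-- The DSTU property: `U₃ t_j^{(r)} U₃ = (t_j^{(r)})ᵀ` for all blocks. -/
def DSTU (m₃ : ℕ) (t : ℤ → ℤ → Matrix (Fin m₃) (Fin m₃) ℂ) : Prop :=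
  ∀ r j : ℤ, Up m₃ * t r j * Up m₃ = (t r j)ᵀ

/-- `q(μ) = ((μ₁-i/2)/(μ₁+i/2))^{m₁} ((μ₂-i/2)/(μ₂+i/2))^{m₂}`. -/
def qfun (m₁ m₂ : ℕ) (mu₁ mu₂ : ℂ) : ℂ :=
  ((mu₁ - Complex.I / 2) / (mu₁ + Complex.I / 2)) ^ m₁ *
    ((mu₂ - Complex.I / 2) / (mu₂ + Complex.I / 2)) ^ m₂


lemma sum_aEnt (i n : ℕ) (h : i + 1 ≤ n) (g : ℕ → ℂ) :
    ∑ j ∈ Finset.range n, aEnt ((i : ℤ) - (j : ℤ)) * g j =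
      Complex.I * (2⁻¹ * g i + ∑ j ∈ Finset.range i, g j) := by
  induction n, h using Nat.le_induction with
  | base =>
    rw [Finset.sum_range_succ]
    have : ∑ j ∈ Finset.range i, aEnt ((i : ℤ) - (j : ℤ)) * g j =
        ∑ j ∈ Finset.range i, Complex.I * g j := by
      refine Finset.sum_congr rfl fun j hj => ?_
      have hj' : j < i := Finset.mem_range.1 hj
      have h1 : ¬ ((i : ℤ) - (j : ℤ) < 0) := by omega
      have h2 : ¬ ((i : ℤ) - (j : ℤ) = 0) := by omega
      simp only [aEnt, h1, h2, if_false]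
    rw [this, ← Finset.mul_sum]
    simp [aEnt]
    ring
  | succ n hn ih =>
    rw [Finset.sum_range_succ, ih]
    have h1 : ((i : ℤ) - (n : ℤ) < 0) := by omega
    simp [aEnt, h1]

lemma shift_sum (f : ℤ → ℂ) (i k : ℕ) :
    f ((i : ℤ) - k) + ∑ j ∈ Finset.range i, f ((j : ℤ) - k) +
      ∑ j ∈ Finset.range k, f ((i : ℤ) - j) =
    f 0 + ∑ s ∈ Finset.range i, f ((s : ℤ) + 1) + ∑ s ∈ Finset.range k, f (-((s : ℤ) + 1)) := by
  induction k with
  | zero =>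
    have h1 := Finset.sum_range_succ (fun j : ℕ => f (j : ℤ)) i
    have h2 := Finset.sum_range_succ' (fun j : ℕ => f (j : ℤ)) i
    push_cast at h1 h2
    simp
    linear_combination h2 - h1
  | succ k ih =>
    rw [Finset.sum_range_succ, Finset.sum_range_succ (fun s : ℕ => f (-((s : ℤ) + 1)))]
    have h1 := Finset.sum_range_succ (fun j : ℕ => f ((j : ℤ) - (k + 1))) i
    have h2 := Finset.sum_range_succ' (fun j : ℕ => f ((j : ℤ) - (k + 1))) i
    push_cast at h1 h2 ⊢
    have h3 : ∀ j : ℕ, f ((j : ℤ) + 1 - (k + 1)) = f ((j : ℤ) - k) := fun j => by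
      congr 1; ring
    simp only [h3] at h2
    have h4 : f (0 - ((k : ℤ) + 1)) = f (-((k : ℤ) + 1)) := by ring_nf
    rw [h4] at h2
    linear_combination ih - h1 + h2

lemma toep (n : ℕ) (f : ℤ → ℂ) (i k : Fin n) :
    ∑ j : Fin n, calA n i j * f (((j : ℕ) : ℤ) - ((k : ℕ) : ℤ)) -
      ∑ j : Fin n, f (((i : ℕ) : ℤ) - ((j : ℕ) : ℤ)) * (calA n)ᴴ j k =
    Complex.I * ((2⁻¹ * f 0 + ∑ s ∈ Finset.range (i : ℕ), f ((s : ℤ) + 1)) +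
      (2⁻¹ * f 0 + ∑ s ∈ Finset.range (k : ℕ), f (-((s : ℤ) + 1)))) := by
  have e1 := sum_aEnt i n i.2 (fun j => f ((j : ℤ) - ((k : ℕ) : ℤ)))
  have e2 := congrArg star (sum_aEnt k n k.2 (fun j => star (f (((i : ℕ) : ℤ) - (j : ℤ)))))
  rw [← Fin.sum_univ_eq_sum_range (fun j => aEnt (((i : ℕ) : ℤ) - (j : ℤ)) * f ((j : ℤ) - ((k : ℕ) : ℤ)))] at e1
  rw [← Fin.sum_univ_eq_sum_range (fun j => aEnt (((k : ℕ) : ℤ) - (j : ℤ)) * star (f (((i : ℕ) : ℤ) - (j : ℤ))))] at e2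
  have e1' : ∑ j : Fin n, calA n i j * f (((j : ℕ) : ℤ) - ((k : ℕ) : ℤ)) = _ := e1
  have e2' : ∑ j : Fin n, f (((i : ℕ) : ℤ) - ((j : ℕ) : ℤ)) * (calA n)ᴴ j k =
    -Complex.I * (2⁻¹ * f (((i : ℕ) : ℤ) - ((k : ℕ) : ℤ)) + ∑ j ∈ Finset.range (k : ℕ), f (((i : ℕ) : ℤ) - (j : ℤ))) := by
    simp only [star_sum, star_mul, star_star, star_add, star_inv₀] at e2
    simp only [conjTranspose_apply, calA, of_apply]
    rw [e2]
    simp [mul_comm]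
  rw [e1', e2']
  have := shift_sum f i k
  linear_combination Complex.I * this

lemma calA_sub (n : ℕ) (i k : Fin n) : calA n i k - (calA n)ᴴ i k = Complex.I := by
  simp only [conjTranspose_apply, calA, of_apply, aEnt]
  rcases lt_trichotomy (i : ℕ) (k : ℕ) with h | h | h
  · have h1 : (((i : ℕ) : ℤ) - ((k : ℕ) : ℤ) < 0) := by omega
    have h2 : ¬ (((k : ℕ) : ℤ) - ((i : ℕ) : ℤ) < 0) := by omega
    have h3 : ¬ (((k : ℕ) : ℤ) - ((i : ℕ) : ℤ) = 0) := by omega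
    simp only [h1, h2, h3, if_true, if_false]
    try simp
  · rw [h]; simp; ring
  · have h1 : (((k : ℕ) : ℤ) - ((i : ℕ) : ℤ) < 0) := by omega
    have h2 : ¬ (((i : ℕ) : ℤ) - ((k : ℕ) : ℤ) < 0) := by omega
    have h3 : ¬ (((i : ℕ) : ℤ) - ((k : ℕ) : ℤ) = 0) := by omega
    simp only [h1, h2, h3, if_true, if_false]
    try simp

lemma isUnit_calA (n : ℕ) (z : ℂ) (hz : z ≠ -(Complex.I / 2)) :
    IsUnit ((calA n)ᴴ - z • 1) := by
  rw [Matrix.isUnit_iff_isUnit_det, Matrix.det_of_isUpperTriangular]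
  · rw [isUnit_iff_ne_zero, Finset.prod_ne_zero_iff]
    intro i _
    simp [calA, aEnt]
    intro h
    apply hz
    linear_combination -h
  · intro i j hij
    have hij' : (j : ℕ) < (i : ℕ) := hij
    have h1 : (((j : ℕ) : ℤ) - ((i : ℕ) : ℤ) < 0) := by omega
    have h2 : i ≠ j := by rintro rfl; omega
    simp only [calA, aEnt, h1, Matrix.sub_apply, Matrix.smul_apply, conjTranspose_apply, of_apply, if_true, Matrix.one_apply_ne h2]
    simp

section entries
variable {m₁ m₂ m₃ : ℕ}

lemma A1_mul {q : Type*} (M : Matrix (Idx m₁ m₂ m₃) q ℂ) (x : Idx m₁ m₂ m₃) (y : q) :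
    (A1 m₁ m₂ m₃ * M) x y = ∑ j, calA m₁ x.1.1 j * M ((j, x.1.2), x.2) y := by
  simp [A1, Matrix.mul_apply, Fintype.sum_prod_type, Matrix.one_apply, ite_mul, mul_ite]

lemma A2_mul {q : Type*} (M : Matrix (Idx m₁ m₂ m₃) q ℂ) (x : Idx m₁ m₂ m₃) (y : q) :
    (A2 m₁ m₂ m₃ * M) x y = ∑ j, calA m₂ x.1.2 j * M ((x.1.1, j), x.2) y := by
  simp [A2, Matrix.mul_apply, Fintype.sum_prod_type, Matrix.one_apply, ite_mul, mul_ite]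

lemma mul_A1H {q : Type*} (M : Matrix q (Idx m₁ m₂ m₃) ℂ) (x : Idx m₁ m₂ m₃) (y : q) :
    (M * (A1 m₁ m₂ m₃)ᴴ) y x = ∑ j, M y ((j, x.1.2), x.2) * (calA m₁)ᴴ j x.1.1 := by
  simp [A1, Matrix.mul_apply, Fintype.sum_prod_type, Matrix.one_apply, ite_mul, mul_ite,
    conjTranspose_kronecker]

lemma mul_A2H {q : Type*} (M : Matrix q (Idx m₁ m₂ m₃) ℂ) (x : Idx m₁ m₂ m₃) (y : q) :
    (M * (A2 m₁ m₂ m₃)ᴴ) y x = ∑ j, M y ((x.1.1, j), x.2) * (calA m₂)ᴴ j x.1.2 := by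
  simp [A2, Matrix.mul_apply, Fintype.sum_prod_type, Matrix.one_apply, ite_mul, mul_ite,
    conjTranspose_kronecker]

lemma mul_kron1 {n : ℕ} {q : Type*} (M : Matrix q (Fin n × Fin m₃) ℂ) (B : Matrix (Fin n) (Fin n) ℂ)
    (y : q) (x : Fin n × Fin m₃) :
    (M * (B ⊗ₖ (1 : Matrix (Fin m₃) (Fin m₃) ℂ))) y x = ∑ j, M y (j, x.2) * B j x.1 := by
  simp [Matrix.mul_apply, Fintype.sum_prod_type, Matrix.one_apply, ite_mul, mul_ite]

lemma kron1_mul {n : ℕ} {q : Type*} (M : Matrix (Fin n × Fin m₃) q ℂ) (B : Matrix (Fin n) (Fin n) ℂ)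
    (y : q) (x : Fin n × Fin m₃) :
    ((B ⊗ₖ (1 : Matrix (Fin m₃) (Fin m₃) ℂ)) * M) x y = ∑ j, B x.1 j * M (j, x.2) y := by
  simp [Matrix.mul_apply, Fintype.sum_prod_type, Matrix.one_apply, ite_mul, mul_ite]

lemma mul_M21 {q : Type*} (M : Matrix q (Fin m₂ × Fin m₃) ℂ) (y : q) (x : Idx m₁ m₂ m₃) :
    (M * M21 m₁ m₂ m₃) y x = M y (x.1.2, x.2) := by
  simp [M21, Matrix.mul_apply, Fintype.sum_prod_type, ite_and]

lemma mul_M22 {q : Type*} (M : Matrix q (Fin m₁ × Fin m₃) ℂ) (y : q) (x : Idx m₁ m₂ m₃) :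
    (M * M22 m₁ m₂ m₃) y x = M y (x.1.1, x.2) := by
  simp [M22, Matrix.mul_apply, Fintype.sum_prod_type, ite_and]

lemma M31_mul {q : Type*} (M : Matrix (Fin m₂ × Fin m₃) q ℂ) (y : q) (x : Idx m₁ m₂ m₃) :
    (M31 m₁ m₂ m₃ * M) x y = M (x.1.2, x.2) y := by
  simp [M31, M21, Matrix.mul_apply, Fintype.sum_prod_type, ite_and, apply_ite (star : ℂ → ℂ), apply_ite (starRingEnd ℂ)]

lemma M32_mul {q : Type*} (M : Matrix (Fin m₁ × Fin m₃) q ℂ) (y : q) (x : Idx m₁ m₂ m₃) :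
    (M32 m₁ m₂ m₃ * M) x y = M (x.1.1, x.2) y := by
  simp [M32, M22, Matrix.mul_apply, Fintype.sum_prod_type, ite_and, apply_ite (star : ℂ → ℂ), apply_ite (starRingEnd ℂ)]

lemma mul_LpH {n : ℕ} {q : Type*} (M : Matrix q (Fin m₃) ℂ) (y : q) (x : Fin n × Fin m₃) :
    (M * (Lp n m₃)ᴴ) y x = M y x.2 := by
  simp [Lp, Matrix.mul_apply, apply_ite (star : ℂ → ℂ), apply_ite (starRingEnd ℂ)]

variable (t : ℤ → ℤ → Matrix (Fin m₃) (Fin m₃) ℂ)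

lemma id1 : A1 m₁ m₂ m₃ * Tmat m₁ m₂ m₃ t - Tmat m₁ m₂ m₃ t * (A1 m₁ m₂ m₃)ᴴ =
    Complex.I • (Pi1 m₁ m₂ m₃ t * Pihat1 m₁ m₂ m₃ t) := by
  ext x y
  rw [Pi1, Pihat1, fromCols_mul_fromRows, Matrix.sub_apply, A1_mul, mul_A1H, Matrix.smul_apply, Matrix.add_apply,
    mul_M21, M31_mul]
  have := toep m₁ (fun r => t r (((x.1.2 : ℕ) : ℤ) - ((y.1.2 : ℕ) : ℤ)) x.2 y.2) x.1.1 y.1.1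
  simpa [Tmat, M11, M41, calT, Matrix.sum_apply] using this

lemma id2 : A2 m₁ m₂ m₃ * Tmat m₁ m₂ m₃ t - Tmat m₁ m₂ m₃ t * (A2 m₁ m₂ m₃)ᴴ =
    Complex.I • (Pi2 m₁ m₂ m₃ t * Pihat2 m₁ m₂ m₃ t) := by
  ext x y
  rw [Pi2, Pihat2, fromCols_mul_fromRows, Matrix.sub_apply, A2_mul, mul_A2H, Matrix.smul_apply, Matrix.add_apply,
    mul_M22, M32_mul]
  have := toep m₂ (fun r => t (((x.1.1 : ℕ) : ℤ) - ((y.1.1 : ℕ) : ℤ)) r x.2 y.2) x.1.2 y.1.2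
  simpa [Tmat, M12, M42, M12blk, M42blk, Matrix.sum_apply] using this

lemma id3 : A1 m₁ m₂ m₃ * M12 m₁ m₂ m₃ t - M12 m₁ m₂ m₃ t * ((calA m₁)ᴴ ⊗ₖ (1 : Matrix (Fin m₃) (Fin m₃) ℂ)) =
    Complex.I • (Nmat m₁ m₂ m₃ t * (Lp m₁ m₃)ᴴ + M31 m₁ m₂ m₃ * K12 m₁ m₂ m₃ t) := by
  ext x y
  rw [Matrix.sub_apply, A1_mul, mul_kron1, Matrix.smul_apply, Matrix.add_apply, mul_LpH, M31_mul]
  have := toep m₁ (fun r => M12blk m₂ m₃ t r (x.1.2, x.2) y.2) x.1.1 y.1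
  simp only [M12, Nmat, K12, of_apply, Matrix.add_apply, Matrix.smul_apply, Matrix.sum_apply, smul_eq_mul]
  exact this

lemma id4 : A1 m₁ m₂ m₃ * M32 m₁ m₂ m₃ - M32 m₁ m₂ m₃ * ((calA m₁)ᴴ ⊗ₖ (1 : Matrix (Fin m₃) (Fin m₃) ℂ)) =
    Complex.I • (M31 m₁ m₂ m₃ * (Lp m₂ m₃ * (Lp m₁ m₃)ᴴ)) := by
  ext x y
  rw [Matrix.sub_apply, A1_mul, M32_mul, Matrix.smul_apply, M31_mul, mul_LpH]
  have := calA_sub m₁ x.1.1 y.1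
  by_cases h : y.2 = x.2
  · simpa [M32, M22, Lp, ite_and, apply_ite (starRingEnd ℂ), h, Matrix.one_apply, eq_comm] using this
  · have h' : x.2 ≠ y.2 := fun e => h e.symm
    simp [M32, M22, Lp, h, h']

lemma id5 : A2 m₁ m₂ m₃ * M11 m₁ m₂ m₃ t - M11 m₁ m₂ m₃ t * ((calA m₂)ᴴ ⊗ₖ (1 : Matrix (Fin m₃) (Fin m₃) ℂ)) =
    Complex.I • (Nmat m₁ m₂ m₃ t * (Lp m₂ m₃)ᴴ + M32 m₁ m₂ m₃ * K11 m₁ m₂ m₃ t) := by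
  ext x y
  rw [Matrix.sub_apply, A2_mul, mul_kron1, Matrix.smul_apply, Matrix.add_apply, mul_LpH, M32_mul]
  have := toep m₂ (fun r => 2⁻¹ * t 0 r x.2 y.2 + ∑ s ∈ Finset.range (x.1.1 : ℕ),
    t ((s : ℤ) + 1) r x.2 y.2) x.1.2 y.1
  simp only [M11, Nmat, K11, calT, M12blk, M42blk, of_apply, Matrix.add_apply, Matrix.smul_apply,
    Matrix.sum_apply, smul_eq_mul] at this ⊢
  rw [this]
  simp only [Finset.sum_add_distrib, ← Finset.mul_sum, Finset.sum_comm (s := Finset.range (x.1.1 : ℕ))]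
  ring

lemma id6 : A2 m₁ m₂ m₃ * M31 m₁ m₂ m₃ - M31 m₁ m₂ m₃ * ((calA m₂)ᴴ ⊗ₖ (1 : Matrix (Fin m₃) (Fin m₃) ℂ)) =
    Complex.I • (M32 m₁ m₂ m₃ * (Lp m₁ m₃ * (Lp m₂ m₃)ᴴ)) := by
  ext x y
  rw [Matrix.sub_apply, A2_mul, M31_mul, Matrix.smul_apply, M32_mul, mul_LpH]
  have := calA_sub m₂ x.1.2 y.1
  by_cases h : y.2 = x.2
  · simpa [M31, M21, Lp, ite_and, apply_ite (starRingEnd ℂ), h, Matrix.one_apply, eq_comm] using this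
  · have h' : x.2 ≠ y.2 := fun e => h e.symm
    simp [M31, M21, Lp, h, h']

lemma rowKronId_mul {n : ℕ} (v : Fin n → ℂ) (B : Matrix (Fin n) (Fin n) ℂ) :
    rowKronId m₃ v * (B ⊗ₖ (1 : Matrix (Fin m₃) (Fin m₃) ℂ)) = rowKronId m₃ (v ᵥ* B) := by
  ext x y
  rw [mul_kron1]
  simp [rowKronId, vecMul, dotProduct, Finset.sum_mul]

lemma rowKronId_one {n : ℕ} : rowKronId m₃ (fun _ : Fin n => (1 : ℂ)) = (Lp n m₃)ᴴ := by
  ext x y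
  simp [rowKronId, Lp, apply_ite (starRingEnd ℂ), eq_comm]

lemma row_inv {n : ℕ} (z : ℂ) (hz : z ≠ -(Complex.I / 2)) :
    rowKronId m₃ ((fun _ : Fin n => (1 : ℂ)) ᵥ* ((calA n)ᴴ - z • 1)⁻¹) *
      (((calA n)ᴴ - z • 1) ⊗ₖ (1 : Matrix (Fin m₃) (Fin m₃) ℂ)) = (Lp n m₃)ᴴ := by
  rw [rowKronId_mul, vecMul_vecMul, nonsing_inv_mul _ ((isUnit_iff_isUnit_det _).1 (isUnit_calA n z hz)),
    vecMul_one, rowKronId_one]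

lemma subk {a b c d : Type*} (A A' : Matrix a b ℂ) (B : Matrix c d ℂ) :
    (A - A') ⊗ₖ B = A ⊗ₖ B - A' ⊗ₖ B := by
  ext x y; simp [sub_mul]

lemma ksub {a b c d : Type*} (A A' : Matrix a b ℂ) (B : Matrix c d ℂ) :
    B ⊗ₖ (A - A') = B ⊗ₖ A - B ⊗ₖ A' := by
  ext x y; simp [mul_sub]

lemma A1H_eq (z : ℂ) : (A1 m₁ m₂ m₃)ᴴ - z • 1 =
    ((((calA m₁)ᴴ - z • 1) ⊗ₖ (1 : Matrix (Fin m₂) (Fin m₂) ℂ)) ⊗ₖ (1 : Matrix (Fin m₃) (Fin m₃) ℂ)) := by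
  simp [A1, conjTranspose_kronecker, subk, smul_kronecker]

lemma A2H_eq (z : ℂ) : (A2 m₁ m₂ m₃)ᴴ - z • 1 =
    (((1 : Matrix (Fin m₁) (Fin m₁) ℂ) ⊗ₖ ((calA m₂)ᴴ - z • 1)) ⊗ₖ (1 : Matrix (Fin m₃) (Fin m₃) ℂ)) := by
  simp [A2, conjTranspose_kronecker, subk, smul_kronecker, ksub, kronecker_smul]

lemma isUnit_kron {a b : Type*} [Fintype a] [Fintype b] [DecidableEq a] [DecidableEq b]
    {A : Matrix a a ℂ} {B : Matrix b b ℂ} (hA : IsUnit A) (hB : IsUnit B) : IsUnit (A ⊗ₖ B) := by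
  rw [isUnit_iff_isUnit_det] at *
  rw [det_kronecker]
  exact (hA.pow _).mul (hB.pow _)

lemma isUnit_A1 (z : ℂ) (hz : z ≠ -(Complex.I / 2)) : IsUnit ((A1 m₁ m₂ m₃)ᴴ - z • 1) := by
  rw [A1H_eq]
  exact isUnit_kron (isUnit_kron (isUnit_calA _ _ hz) isUnit_one) isUnit_one

lemma isUnit_A2 (z : ℂ) (hz : z ≠ -(Complex.I / 2)) : IsUnit ((A2 m₁ m₂ m₃)ᴴ - z • 1) := by
  rw [A2H_eq]
  exact isUnit_kron (isUnit_kron isUnit_one (isUnit_calA _ _ hz)) isUnit_one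

lemma A_comm (z w : ℂ) : Commute ((A1 m₁ m₂ m₃)ᴴ - z • 1) ((A2 m₁ m₂ m₃)ᴴ - w • 1) := by
  rw [A1H_eq, A2H_eq, Commute, SemiconjBy, ← mul_kronecker_mul, ← mul_kronecker_mul,
    ← mul_kronecker_mul, ← mul_kronecker_mul]
  simp

lemma M21_A2 : M21 m₁ m₂ m₃ * (A2 m₁ m₂ m₃)ᴴ = ((calA m₂)ᴴ ⊗ₖ (1 : Matrix (Fin m₃) (Fin m₃) ℂ)) * M21 m₁ m₂ m₃ := by
  ext y x
  rw [mul_A2H, kron1_mul]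
  by_cases h : y.2 = x.2 <;> simp [M21, ite_and, h]

lemma M22_A1 : M22 m₁ m₂ m₃ * (A1 m₁ m₂ m₃)ᴴ = ((calA m₁)ᴴ ⊗ₖ (1 : Matrix (Fin m₃) (Fin m₃) ℂ)) * M22 m₁ m₂ m₃ := by
  ext y x
  rw [mul_A1H, kron1_mul]
  by_cases h : y.2 = x.2 <;> simp [M22, ite_and, h]

lemma L_M21 : (Lp m₂ m₃)ᴴ * M21 m₁ m₂ m₃ = (Lmat m₁ m₂ m₃)ᴴ := by
  ext y x
  rw [mul_M21]; simp [Lp, Lmat]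

lemma L_M22 : (Lp m₁ m₃)ᴴ * M22 m₁ m₂ m₃ = (Lmat m₁ m₂ m₃)ᴴ := by
  ext y x
  rw [mul_M22]; simp [Lp, Lmat]

lemma X2 (z : ℂ) (hz : z ≠ -(Complex.I / 2)) :
    rowKronId m₃ ((fun _ : Fin m₂ => (1 : ℂ)) ᵥ* ((calA m₂)ᴴ - z • 1)⁻¹) * M21 m₁ m₂ m₃ =
      (Lmat m₁ m₂ m₃)ᴴ * ((A2 m₁ m₂ m₃)ᴴ - z • 1)⁻¹ := by
  have hu := (isUnit_iff_isUnit_det _).1 (isUnit_A2 (m₁ := m₁) (m₂ := m₂) (m₃ := m₃) z hz)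
  have h : M21 m₁ m₂ m₃ * ((A2 m₁ m₂ m₃)ᴴ - z • 1) =
      (((calA m₂)ᴴ - z • 1) ⊗ₖ (1 : Matrix (Fin m₃) (Fin m₃) ℂ)) * M21 m₁ m₂ m₃ := by
    rw [Matrix.mul_sub, M21_A2, subk, Matrix.sub_mul]; simp [smul_kronecker]
  rw [← L_M21, ← row_inv (n := m₂) z hz, Matrix.mul_assoc (rowKronId _ _), ← h, ← Matrix.mul_assoc,
    mul_nonsing_inv_cancel_right _ _ hu]

lemma X1 (z : ℂ) (hz : z ≠ -(Complex.I / 2)) :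
    rowKronId m₃ ((fun _ : Fin m₁ => (1 : ℂ)) ᵥ* ((calA m₁)ᴴ - z • 1)⁻¹) * M22 m₁ m₂ m₃ =
      (Lmat m₁ m₂ m₃)ᴴ * ((A1 m₁ m₂ m₃)ᴴ - z • 1)⁻¹ := by
  have hu := (isUnit_iff_isUnit_det _).1 (isUnit_A1 (m₁ := m₁) (m₂ := m₂) (m₃ := m₃) z hz)
  have h : M22 m₁ m₂ m₃ * ((A1 m₁ m₂ m₃)ᴴ - z • 1) =
      (((calA m₁)ᴴ - z • 1) ⊗ₖ (1 : Matrix (Fin m₃) (Fin m₃) ℂ)) * M22 m₁ m₂ m₃ := by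
    rw [Matrix.mul_sub, M22_A1, subk, Matrix.sub_mul]; simp [smul_kronecker]
  rw [← L_M22, ← row_inv (n := m₁) z hz, Matrix.mul_assoc (rowKronId _ _), ← h, ← Matrix.mul_assoc,
    mul_nonsing_inv_cancel_right _ _ hu]

end entries

lemma abstract_id {l n p q : Type*} [Fintype l] [Fintype n] [Fintype p] [Fintype q]
    [DecidableEq n]
    (W X : Matrix l n ℂ) (T A A' : Matrix n n ℂ) (Pi : Matrix n p ℂ) (Ph : Matrix p n ℂ)
    (P Z : Matrix n q ℂ) (D : Matrix q q ℂ) (B : Matrix p q ℂ) (e : Matrix l p ℂ)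
    (e' c : Matrix l q ℂ) (mu : ℂ) (hT : IsUnit T)
    (h1 : A * T - T * A' = Complex.I • (Pi * Ph))
    (h2 : W * A' = X + mu • W) (h3 : e * Ph = X) (h4 : e * B = 0) (h5 : e' * D = c)
    (h6 : P * D = A * P - mu • P - Complex.I • (Pi * B) - Complex.I • Z) :
    (W * (T⁻¹ * P) - Complex.I • e') * D +
      (W * (T⁻¹ * Pi) - Complex.I • e) * ((-Complex.I) • (Ph * (T⁻¹ * P) - B)) =
    (-Complex.I) • (c + W * T⁻¹ * Z) := by
  have hd := (isUnit_iff_isUnit_det _).1 hT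
  have h7 : T⁻¹ * (Pi * (Ph * (T⁻¹ * P))) =
      (-Complex.I) • (T⁻¹ * (A * P) - A' * (T⁻¹ * P)) := by
    have e1 : Pi * Ph = (-Complex.I) • (A * T - T * A') := by
      rw [h1, smul_smul]; simp
    rw [← Matrix.mul_assoc Pi, e1]
    simp only [Matrix.smul_mul, Matrix.mul_smul, Matrix.sub_mul, Matrix.mul_sub]
    congr 2
    · rw [Matrix.mul_assoc A, mul_nonsing_inv_cancel_left _ _ hd]
    · rw [Matrix.mul_assoc T, nonsing_inv_mul_cancel_left _ _ hd]
  simp only [Matrix.sub_mul, Matrix.mul_sub, Matrix.smul_mul, Matrix.mul_smul, Matrix.mul_assoc,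
    h5, h6, h4, h7]
  rw [← Matrix.mul_assoc W A', h2, ← Matrix.mul_assoc e, h3]
  simp only [Matrix.add_mul, Matrix.smul_mul, smul_sub, smul_add, smul_smul, neg_mul, mul_neg,
    Complex.I_mul_I, neg_neg, one_smul, smul_zero]
  match_scalars <;> ring_nf <;> simp [Complex.I_sq]

/-- Theorem 3.2: `u(μ) E(μ) = ϑ(μ) [ℒ₂^* 0 ℒ₁^* 0]`, and, if `E(μ)` is
invertible, `u(μ) = ϑ(μ) [ℒ₂^* 0 ℒ₁^* 0] E(μ)⁻¹`. -/
theorem statement14 (m₁ m₂ m₃ : ℕ) (hm₁ : 2 ≤ m₁) (hm₂ : 2 ≤ m₂) (hm₃ : 2 ≤ m₃)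
    (t : ℤ → ℤ → Matrix (Fin m₃) (Fin m₃) ℂ) (hT : IsUnit (Tmat m₁ m₂ m₃ t))
    (mu₁ mu₂ : ℂ)
    (hmu₁ : mu₁ ≠ Complex.I / 2) (hmu₁' : mu₁ ≠ -(Complex.I / 2))
    (hmu₂ : mu₂ ≠ Complex.I / 2) (hmu₂' : mu₂ ≠ -(Complex.I / 2)) :
    Matrix.fromCols (u1 m₁ m₂ m₃ t mu₁ mu₂) (u2 m₁ m₂ m₃ t mu₁ mu₂) *
        Emat m₁ m₂ m₃ t mu₁ mu₂ =
      vartheta m₁ m₂ m₃ t mu₁ mu₂ *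
        Matrix.fromCols (Matrix.fromCols ((Lp m₂ m₃)ᴴ) 0)
          (Matrix.fromCols ((Lp m₁ m₃)ᴴ) 0) ∧
    (IsUnit (Emat m₁ m₂ m₃ t mu₁ mu₂) →
      Matrix.fromCols (u1 m₁ m₂ m₃ t mu₁ mu₂) (u2 m₁ m₂ m₃ t mu₁ mu₂) =
        vartheta m₁ m₂ m₃ t mu₁ mu₂ *
          Matrix.fromCols (Matrix.fromCols ((Lp m₂ m₃)ᴴ) 0)
            (Matrix.fromCols ((Lp m₁ m₃)ᴴ) 0) *
          (Emat m₁ m₂ m₃ t mu₁ mu₂)⁻¹) := by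
  have d1 := (isUnit_iff_isUnit_det _).1 (isUnit_A1 (m₁ := m₁) (m₂ := m₂) (m₃ := m₃) mu₁ hmu₁')
  have d2 := (isUnit_iff_isUnit_det _).1 (isUnit_A2 (m₁ := m₁) (m₂ := m₂) (m₃ := m₃) mu₂ hmu₂')
  have hc := (A_comm (m₁ := m₁) (m₂ := m₂) (m₃ := m₃) mu₁ mu₂).eq
  set W := (Lmat m₁ m₂ m₃)ᴴ * ((A1 m₁ m₂ m₃)ᴴ - mu₁ • 1)⁻¹ * ((A2 m₁ m₂ m₃)ᴴ - mu₂ • 1)⁻¹ with hW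
  have w2 : W * (A2 m₁ m₂ m₃)ᴴ =
      (Lmat m₁ m₂ m₃)ᴴ * ((A1 m₁ m₂ m₃)ᴴ - mu₁ • 1)⁻¹ + mu₂ • W := by
    have : W * ((A2 m₁ m₂ m₃)ᴴ - mu₂ • 1) =
      (Lmat m₁ m₂ m₃)ᴴ * ((A1 m₁ m₂ m₃)ᴴ - mu₁ • 1)⁻¹ := nonsing_inv_mul_cancel_right _ _ d2
    rw [← this, Matrix.mul_sub]; simp
  have w1 : W * (A1 m₁ m₂ m₃)ᴴ =
      (Lmat m₁ m₂ m₃)ᴴ * ((A2 m₁ m₂ m₃)ᴴ - mu₂ • 1)⁻¹ + mu₁ • W := by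
    have : W * ((A1 m₁ m₂ m₃)ᴴ - mu₁ • 1) =
        (Lmat m₁ m₂ m₃)ᴴ * ((A2 m₁ m₂ m₃)ᴴ - mu₂ • 1)⁻¹ := by
      rw [hW, Matrix.mul_assoc (Lmat m₁ m₂ m₃)ᴴ, ← Matrix.mul_inv_rev, ← hc, Matrix.mul_inv_rev,
        ← Matrix.mul_assoc, nonsing_inv_mul_cancel_right _ _ d1]
    rw [← this, Matrix.mul_sub]; simp
  have main : Matrix.fromCols (u1 m₁ m₂ m₃ t mu₁ mu₂) (u2 m₁ m₂ m₃ t mu₁ mu₂) *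
        Emat m₁ m₂ m₃ t mu₁ mu₂ =
      vartheta m₁ m₂ m₃ t mu₁ mu₂ *
        Matrix.fromCols (Matrix.fromCols ((Lp m₂ m₃)ᴴ) 0)
          (Matrix.fromCols ((Lp m₁ m₃)ᴴ) 0) := by
    have g1 := abstract_id W _ (Tmat m₁ m₂ m₃ t) (A2 m₁ m₂ m₃) (A2 m₁ m₂ m₃)ᴴ
      (Pi2 m₁ m₂ m₃ t) (Pihat2 m₁ m₂ m₃ t) (Pi1 m₁ m₂ m₃ t)
      (Nmat m₁ m₂ m₃ t * fromCols (Lp m₂ m₃)ᴴ 0) (diagKronH m₂ m₃ mu₂)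
      (Matrix.fromBlocks 0 0 (K11 m₁ m₂ m₃ t) (Lp m₁ m₃ * (Lp m₂ m₃)ᴴ))
      (Matrix.fromCols (rowKronId m₃
        (Matrix.vecMul (fun _ : Fin m₁ => (1 : ℂ)) (((calA m₁)ᴴ - mu₁ • 1)⁻¹))) 0)
      (Matrix.fromCols (rowKronId m₃
        (Matrix.vecMul (fun _ : Fin m₂ => (1 : ℂ)) (((calA m₂)ᴴ - mu₂ • 1)⁻¹))) 0)
      (fromCols (Lp m₂ m₃)ᴴ 0) mu₂ hT (id2 t) w2
      (by rw [Pihat2, fromCols_mul_fromRows, X1 _ hmu₁', Matrix.zero_mul, add_zero])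
      (by simp [fromCols_mul_fromBlocks])
      (by rw [diagKronH, fromCols_mul_fromBlocks, row_inv _ hmu₂']; simp)
      (by
        have a := id5 (m₁ := m₁) (m₂ := m₂) t
        have b := id6 (m₁ := m₁) (m₂ := m₂) (m₃ := m₃)
        rw [sub_eq_iff_eq_add] at a b
        rw [diagKronH, Pi1, Pi2, fromCols_mul_fromBlocks, fromCols_mul_fromBlocks, mul_fromCols,
          mul_fromCols, a, b]
        ext x (y | y)
        · simp [subk, smul_kronecker, Matrix.mul_sub]; ring
        · simp [subk, smul_kronecker, Matrix.mul_sub]; ring)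
    have g2 := abstract_id W _ (Tmat m₁ m₂ m₃ t) (A1 m₁ m₂ m₃) (A1 m₁ m₂ m₃)ᴴ
      (Pi1 m₁ m₂ m₃ t) (Pihat1 m₁ m₂ m₃ t) (Pi2 m₁ m₂ m₃ t)
      (Nmat m₁ m₂ m₃ t * fromCols (Lp m₁ m₃)ᴴ 0) (diagKronH m₁ m₃ mu₁)
      (Matrix.fromBlocks 0 0 (K12 m₁ m₂ m₃ t) (Lp m₂ m₃ * (Lp m₁ m₃)ᴴ))
      (Matrix.fromCols (rowKronId m₃
        (Matrix.vecMul (fun _ : Fin m₂ => (1 : ℂ)) (((calA m₂)ᴴ - mu₂ • 1)⁻¹))) 0)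
      (Matrix.fromCols (rowKronId m₃
        (Matrix.vecMul (fun _ : Fin m₁ => (1 : ℂ)) (((calA m₁)ᴴ - mu₁ • 1)⁻¹))) 0)
      (fromCols (Lp m₁ m₃)ᴴ 0) mu₁ hT (id1 t) w1
      (by rw [Pihat1, fromCols_mul_fromRows, X2 _ hmu₂', Matrix.zero_mul, add_zero])
      (by simp [fromCols_mul_fromBlocks])
      (by rw [diagKronH, fromCols_mul_fromBlocks, row_inv _ hmu₁']; simp)
      (by
        have a := id3 (m₁ := m₁) (m₂ := m₂) t
        have b := id4 (m₁ := m₁) (m₂ := m₂) (m₃ := m₃)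
        rw [sub_eq_iff_eq_add] at a b
        rw [diagKronH, Pi1, Pi2, fromCols_mul_fromBlocks, fromCols_mul_fromBlocks, mul_fromCols,
          mul_fromCols, a, b]
        ext x (y | y)
        · simp [subk, smul_kronecker, Matrix.mul_sub]; ring
        · simp [subk, smul_kronecker, Matrix.mul_sub]; ring)
    rw [Emat, fromCols_mul_fromBlocks, mul_fromCols]
    congr 1
    · rw [u1, u2, v1, v2, Gamma1, Gamma2, E21m, vartheta, Gamma1, ← hW, g1]
      rw [Matrix.smul_mul, Matrix.add_mul, Matrix.one_mul, Matrix.mul_assoc (W * _)]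
    · rw [add_comm, u1, u2, v1, v2, Gamma1, Gamma2, E12m, vartheta, Gamma2, ← hW, g2]
      rw [Matrix.smul_mul, Matrix.add_mul, Matrix.one_mul, Matrix.mul_assoc (W * _)]
  refine ⟨main, fun hE => ?_⟩
  have hd := (isUnit_iff_isUnit_det _).1 hE
  have e1 := mul_nonsing_inv_cancel_right _
    (Matrix.fromCols (u1 m₁ m₂ m₃ t mu₁ mu₂) (u2 m₁ m₂ m₃ t mu₁ mu₂)) hd
  exact e1.symm.trans (congrArg (fun Q => Q * (Emat m₁ m₂ m₃ t mu₁ mu₂)⁻¹) main)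

end TBT
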